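/- Let g : ℝ → M₂(ℂ) be a smooth curve with det g(s) = 1 for all s, satisfying dg/ds(s) = g(s)·B(s) where B(s) = b₁(s)B₁ + b₂(s)B₂ + b₃(s)B₃ for smooth real functions b₁, b₂, b₃. Let X(s) = g(s)·g(s)* and write X(s) = !![x₀(s)+x₁(s), x₂(s)+i·x₃(s); x₂(s)−i·x₃(s), x₀(s)−x₁(s)] with real functions x₀, x₁, x₂, x₃. Then for all s: (x₀′(s))² − (x₁′(s))² − (x₂′(s))² − (x₃′(s))² = −(b₁(s)² + b₂(s)² + b₃(s)²); equivalently, det(dX/ds(s)) = −(b₁(s)² + b₂(s)² + b₃(s)²). -/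

import Mathlib

open Matrix

noncomputable section

attribute [local instance] Matrix.normedAddCommGroup Matrix.normedSpace

/-- The Hermitian Pauli matrix `B₁`. -/
def B1 : Matrix (Fin 2) (Fin 2) ℂ := (1 / 2 : ℂ) • !![1, 0; 0, -1]

/-- The Hermitian Pauli matrix `B₂`. -/
def B2 : Matrix (Fin 2) (Fin 2) ℂ := (1 / 2 : ℂ) • !![0, -Complex.I; Complex.I, 0]

/-- The Hermitian Pauli matrix `B₃`. -/
def B3 : Matrix (Fin 2) (Fin 2) ℂ := (1 / 2 : ℂ) • !![0, 1; 1, 0]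

/-- A curve of complex matrices is differentiable iff all its entries are. -/
theorem hasDerivAt_matrix_iff {m n : Type*} [Fintype m] [Fintype n] {f : ℝ → Matrix m n ℂ}
    {f' : Matrix m n ℂ} {s : ℝ} :
    HasDerivAt f f' s ↔ ∀ i j, HasDerivAt (fun t => f t i j) (f' i j) s :=
  hasDerivAt_pi.trans <| forall_congr' fun _ => hasDerivAt_pi

/-- The derivative of `g gᴴ` along a curve of complex matrices. -/
theorem HasDerivAt.matrix_mul_conjTranspose {m n : Type*} [Fintype m] [Fintype n]
    {g : ℝ → Matrix m n ℂ} {g' : Matrix m n ℂ} {s : ℝ} (hg : HasDerivAt g g' s) :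
    HasDerivAt (fun t => g t * (g t)ᴴ) (g' * (g s)ᴴ + g s * g'ᴴ) s := by
  rw [hasDerivAt_matrix_iff] at hg ⊢
  intro i j
  simp only [Matrix.add_apply, Matrix.mul_apply, Matrix.conjTranspose_apply,
    ← Finset.sum_add_distrib]
  exact HasDerivAt.fun_sum fun k _ => (hg i k).mul (hg j k).star

/-- A real linear combination of the Pauli matrices is Hermitian. -/
theorem isHermitian_pauli_combination (a b c : ℝ) :
    ((a : ℂ) • B1 + (b : ℂ) • B2 + (c : ℂ) • B3).IsHermitian := by
  ext i j
  fin_cases i <;> fin_cases j <;> simp [B1, B2, B3]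

theorem det_pauli_combination (a b c : ℂ) :
    (a • B1 + b • B2 + c • B3).det = -(a ^ 2 + b ^ 2 + c ^ 2) / 4 := by
  simp only [B1, B2, B3, Matrix.det_fin_two, Matrix.add_apply, Matrix.smul_apply, smul_eq_mul,
    Matrix.of_apply, Matrix.cons_val', Matrix.cons_val_zero, Matrix.cons_val_one,
    Matrix.cons_val_fin_one]
  linear_combination (b ^ 2 / 4) * Complex.I_sq

/-- The derivative of a differentiable curve of Hermitian `2 × 2` matrices has the derivatives of
the coordinates of the curve as its coordinates. -/
theorem deriv_hermitian_coordinates {X : ℝ → Matrix (Fin 2) (Fin 2) ℂ} {x₀ x₁ x₂ x₃ : ℝ → ℝ}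
    (hcoord : ∀ s, X s
      = !![(x₀ s : ℂ) + x₁ s, (x₂ s : ℂ) + Complex.I * x₃ s;
           (x₂ s : ℂ) - Complex.I * x₃ s, (x₀ s : ℂ) - x₁ s])
    {s : ℝ} (hX : DifferentiableAt ℝ X s) :
    deriv X s
      = !![((deriv x₀ s : ℝ) : ℂ) + (deriv x₁ s : ℝ),
           ((deriv x₂ s : ℝ) : ℂ) + Complex.I * (deriv x₃ s : ℝ);
           ((deriv x₂ s : ℝ) : ℂ) - Complex.I * (deriv x₃ s : ℝ),
           ((deriv x₀ s : ℝ) : ℂ) - (deriv x₁ s : ℝ)] := by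
  have h := hasDerivAt_matrix_iff.1 hX.hasDerivAt
  have hre : ∀ i j, DifferentiableAt ℝ (fun t => (X t i j).re) s := fun i j =>
    (Complex.reCLM.hasFDerivAt.comp_hasDerivAt s (h i j)).differentiableAt
  have him : ∀ i j, DifferentiableAt ℝ (fun t => (X t i j).im) s := fun i j =>
    (Complex.imCLM.hasFDerivAt.comp_hasDerivAt s (h i j)).differentiableAt
  have h₀ : DifferentiableAt ℝ x₀ s :=
    (((hre 0 0).add (hre 1 1)).div_const 2).congr_of_eventuallyEq <|
      .of_forall fun t => by simp [hcoord]
  have h₁ : DifferentiableAt ℝ x₁ s :=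
    (((hre 0 0).sub (hre 1 1)).div_const 2).congr_of_eventuallyEq <|
      .of_forall fun t => by simp [hcoord]
  have h₂ : DifferentiableAt ℝ x₂ s :=
    (hre 0 1).congr_of_eventuallyEq <| .of_forall fun t => by simp [hcoord]
  have h₃ : DifferentiableAt ℝ x₃ s :=
    (him 0 1).congr_of_eventuallyEq <| .of_forall fun t => by simp [hcoord]
  have c₀ := h₀.hasDerivAt.ofReal_comp
  have c₁ := h₁.hasDerivAt.ofReal_comp
  have c₂ := h₂.hasDerivAt.ofReal_comp
  have c₃ := h₃.hasDerivAt.ofReal_comp.const_mul Complex.I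
  refine HasDerivAt.deriv (hasDerivAt_matrix_iff.2 fun i j => ?_)
  simp only [hcoord]
  fin_cases i <;> fin_cases j
  · exact c₀.add c₁
  · exact c₂.add c₃
  · exact c₂.sub c₃
  · exact c₀.sub c₁

theorem stmt_12 (g : ℝ → Matrix (Fin 2) (Fin 2) ℂ) (b₁ b₂ b₃ : ℝ → ℝ)
    (hg : ContDiff ℝ (⊤ : ℕ∞) g)
    (hb₁ : ContDiff ℝ (⊤ : ℕ∞) b₁) (hb₂ : ContDiff ℝ (⊤ : ℕ∞) b₂) (hb₃ : ContDiff ℝ (⊤ : ℕ∞) b₃)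
    (hdet : ∀ s, (g s).det = 1)
    (hode : ∀ s, deriv g s
      = g s * ((b₁ s : ℂ) • B1 + (b₂ s : ℂ) • B2 + (b₃ s : ℂ) • B3))
    (X : ℝ → Matrix (Fin 2) (Fin 2) ℂ)
    (hX : ∀ s, X s = g s * (g s)ᴴ)
    (x₀ x₁ x₂ x₃ : ℝ → ℝ)
    (hcoord : ∀ s, X s
      = !![(x₀ s : ℂ) + x₁ s, (x₂ s : ℂ) + Complex.I * x₃ s;
           (x₂ s : ℂ) - Complex.I * x₃ s, (x₀ s : ℂ) - x₁ s]) :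
    ∀ s, (deriv x₀ s) ^ 2 - (deriv x₁ s) ^ 2 - (deriv x₂ s) ^ 2 - (deriv x₃ s) ^ 2
        = -(b₁ s ^ 2 + b₂ s ^ 2 + b₃ s ^ 2)
      ∧ (deriv X s).det = ((-(b₁ s ^ 2 + b₂ s ^ 2 + b₃ s ^ 2) : ℝ) : ℂ) := by
  intro s
  have hg' := ((hg.differentiable (by simp)) s).hasDerivAt.congr_deriv (hode s)
  have hX' : HasDerivAt X _ s := (funext hX : X = _) ▸ hg'.matrix_mul_conjTranspose
  have hdetX : (deriv X s).det = ((-(b₁ s ^ 2 + b₂ s ^ 2 + b₃ s ^ 2) : ℝ) : ℂ) := by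
    rw [show deriv X s = _ from hX'.deriv, Matrix.conjTranspose_mul,
      isHermitian_pauli_combination, ← Matrix.mul_assoc, ← two_smul ℂ, Matrix.det_smul,
      Matrix.det_mul, Matrix.det_mul, Matrix.det_conjTranspose, hdet, det_pauli_combination]
    simp
    ring
  refine ⟨?_, hdetX⟩
  rw [deriv_hermitian_coordinates hcoord hX'.differentiableAt, Matrix.det_fin_two_of] at hdetX
  rw [← Complex.ofReal_inj, ← hdetX]
  push_cast
  linear_combination (-((deriv x₃ s : ℝ) : ℂ) ^ 2) * Complex.I_sq
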